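/- Let n be a positive integer, let γₙ = [[n,0],[0,1]], let ψ ∈ 𝓛_ℚ, and let γ ∈ GL₂(ℚ)⁺. Then L_{γψ} = L_ψ and L_{γₙγψ} = L_{γₙψ} (i.e. πₙ(γψ) = πₙ(ψ)) if and only if γ ∈ Γ₀(n), i.e. if and only if γ has integer entries, determinant 1, and lower-left entry divisible by n. Consequently, πₙ : 𝓛_ℚ → 𝓛ₙ, ψ ↦ (L_ψ, L_{γₙψ}), is a quotient map for the left action of Γ₀(n) on 𝓛_ℚ. -/

import Mathlib

open Matrix

/-- The left action of a rational 2×2 matrix `γ` on `ψ : ℚ² →+ ℂ`, given by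
`(γψ)(v) = (det γ)⁻¹ · ψ(vγ)` where `v` is a row vector. -/
noncomputable def actL (γ : Matrix (Fin 2) (Fin 2) ℚ) (ψ : (Fin 2 → ℚ) →+ ℂ) :
    (Fin 2 → ℚ) →+ ℂ :=
  AddMonoidHom.mk' (fun v => ((γ.det : ℚ) : ℂ)⁻¹ * ψ (v ᵥ* γ))
    (fun v w => by simp only [Matrix.add_vecMul, map_add, mul_add])

/-- The lattice `L_ψ = ℤ·ψ(1,0) + ℤ·ψ(0,1)`. -/
noncomputable def latticeOf (ψ : (Fin 2 → ℚ) →+ ℂ) : AddSubgroup ℂ :=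
  AddSubgroup.closure {ψ ![1, 0], ψ ![0, 1]}

/-- Membership in `𝓛_ℚ`: `ψ(1,0)` and `ψ(0,1)` are `ℝ`-linearly independent and
`ψ(1,0)/ψ(0,1)` lies in the upper half-plane. -/
def IsLQ (ψ : (Fin 2 → ℚ) →+ ℂ) : Prop :=
  LinearIndependent ℝ ![ψ ![1, 0], ψ ![0, 1]] ∧ 0 < (ψ ![1, 0] / ψ ![0, 1]).im

lemma psi_eq (ψ : (Fin 2 → ℚ) →+ ℂ) (v : Fin 2 → ℚ) :
    ψ v = (v 0 : ℂ) * ψ ![1, 0] + (v 1 : ℂ) * ψ ![0, 1] := by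
  have h : v = v 0 • ![1, 0] + v 1 • ![0, 1] := by
    ext i; fin_cases i <;> simp
  have hs : ∀ (q : ℚ) (w : Fin 2 → ℚ), ψ (q • w) = (q : ℂ) * ψ w := by
    intro q w
    rw [map_rat_smul ψ q w, Rat.smul_def]
  conv_lhs => rw [h]
  rw [map_add, hs, hs]

lemma indep_eq {x y : ℂ} (h : LinearIndependent ℝ ![x, y]) {p q r s : ℚ}
    (e : (p : ℂ) * x + q * y = r * x + s * y) : p = r ∧ q = s := by
  rw [LinearIndependent.pair_iff] at h
  have := h ((p : ℝ) - r) ((q : ℝ) - s) (by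
    simp only [Complex.real_smul]
    push_cast
    linear_combination e)
  constructor
  · have h1 : (p : ℝ) = r := by linarith [this.1]
    exact_mod_cast h1
  · have h1 : (q : ℝ) = s := by linarith [this.2]
    exact_mod_cast h1

lemma mem_lat (ψ : (Fin 2 → ℚ) →+ ℂ) (z : ℂ) :
    z ∈ latticeOf ψ ↔ ∃ m k : ℤ, (m : ℂ) * ψ ![1, 0] + k * ψ ![0, 1] = z := by
  unfold latticeOf
  rw [AddSubgroup.mem_closure_pair]
  simp only [zsmul_eq_mul]

lemma lat_le (φ ψ : (Fin 2 → ℚ) →+ ℂ) :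
    latticeOf φ ≤ latticeOf ψ ↔ φ ![1, 0] ∈ latticeOf ψ ∧ φ ![0, 1] ∈ latticeOf ψ := by
  conv_lhs => rw [latticeOf]
  rw [AddSubgroup.closure_le, Set.insert_subset_iff, Set.singleton_subset_iff]
  rfl

lemma act1 (γ : Matrix (Fin 2) (Fin 2) ℚ) (ψ : (Fin 2 → ℚ) →+ ℂ) :
    actL γ ψ ![1, 0] = ((γ.det : ℚ) : ℂ)⁻¹ * (γ 0 0 * ψ ![1, 0] + γ 0 1 * ψ ![0, 1]) := by
  change ((γ.det : ℚ) : ℂ)⁻¹ * ψ (![1, 0] ᵥ* γ) = _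
  rw [psi_eq ψ (![1, 0] ᵥ* γ)]
  simp [Matrix.vecMul, dotProduct, Fin.sum_univ_two]

lemma act2 (γ : Matrix (Fin 2) (Fin 2) ℚ) (ψ : (Fin 2 → ℚ) →+ ℂ) :
    actL γ ψ ![0, 1] = ((γ.det : ℚ) : ℂ)⁻¹ * (γ 1 0 * ψ ![1, 0] + γ 1 1 * ψ ![0, 1]) := by
  change ((γ.det : ℚ) : ℂ)⁻¹ * ψ (![0, 1] ᵥ* γ) = _
  rw [psi_eq ψ (![0, 1] ᵥ* γ)]
  simp [Matrix.vecMul, dotProduct, Fin.sum_univ_two]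

lemma actn1 (n : ℕ) (hn : 0 < n) (ψ : (Fin 2 → ℚ) →+ ℂ) :
    actL !![(n : ℚ), 0; 0, 1] ψ ![1, 0] = ψ ![1, 0] := by
  have : (n : ℂ) ≠ 0 := by exact_mod_cast hn.ne'
  rw [act1]
  simp [Matrix.det_fin_two, this]

lemma actn2 (n : ℕ) (ψ : (Fin 2 → ℚ) →+ ℂ) :
    actL !![(n : ℚ), 0; 0, 1] ψ ![0, 1] = (n : ℂ)⁻¹ * ψ ![0, 1] := by
  rw [act2]
  simp [Matrix.det_fin_two]

/-- for `ψ ∈ 𝓛_ℚ`, `γ ∈ GL₂(ℚ)⁺` and `γₙ = [[n,0],[0,1]]`, one has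
`L_{γψ} = L_ψ` and `L_{γₙγψ} = L_{γₙψ}` (i.e. `πₙ(γψ) = πₙ(ψ)`) if and only if
`γ ∈ Γ₀(n)`, i.e. `γ` has integer entries, determinant `1`, and lower-left entry
divisible by `n`.  Consequently `πₙ` is a quotient map for the left action of
`Γ₀(n)` on `𝓛_ℚ`. -/
theorem stmt8 (n : ℕ) (hn : 0 < n) (ψ : (Fin 2 → ℚ) →+ ℂ) (hψ : IsLQ ψ)
    (γ : Matrix (Fin 2) (Fin 2) ℚ) (hγ : 0 < γ.det) :
    (latticeOf (actL γ ψ) = latticeOf ψ ∧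
      latticeOf (actL !![(n : ℚ), 0; 0, 1] (actL γ ψ)) =
        latticeOf (actL !![(n : ℚ), 0; 0, 1] ψ)) ↔
    (∃ g : Matrix (Fin 2) (Fin 2) ℤ, g.det = 1 ∧ (n : ℤ) ∣ g 1 0 ∧
      γ = g.map (Int.cast : ℤ → ℚ)) := by
  have hnC : (n : ℂ) ≠ 0 := by exact_mod_cast hn.ne'
  have hnQ : (n : ℚ) ≠ 0 := by exact_mod_cast hn.ne'
  have hli := hψ.1
  constructor
  · rintro ⟨h1, h2⟩
    obtain ⟨u1, u2⟩ := (lat_le _ _).1 h1.le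
    obtain ⟨v1, v2⟩ := (lat_le _ _).1 h1.ge
    obtain ⟨-, w2⟩ := (lat_le _ _).1 h2.le
    rw [mem_lat] at u1 u2 v1 v2 w2
    rw [actn1 n hn, actn2, actn2] at w2
    rw [act1] at u1 
    rw [act2] at u2 w2
    rw [act1, act2] at v1 v2
    obtain ⟨a, b, u1⟩ := u1
    obtain ⟨c, d, u2⟩ := u2
    obtain ⟨a', b', v1⟩ := v1
    obtain ⟨c', d', v2⟩ := v2
    obtain ⟨e, f, w2⟩ := w2
    have hdet := Matrix.det_fin_two γ
    generalize γ.det = D at *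
    have U1 := indep_eq hli (p := a) (q := b) (r := D⁻¹ * γ 0 0) (s := D⁻¹ * γ 0 1)
      (by push_cast; linear_combination u1)
    have U2 := indep_eq hli (p := c) (q := d) (r := D⁻¹ * γ 1 0) (s := D⁻¹ * γ 1 1)
      (by push_cast; linear_combination u2)
    have V1 := indep_eq hli (p := a' * (D⁻¹ * γ 0 0) + b' * (D⁻¹ * γ 1 0))
      (q := a' * (D⁻¹ * γ 0 1) + b' * (D⁻¹ * γ 1 1)) (r := 1) (s := 0)
      (by push_cast; linear_combination v1)
    have V2 := indep_eq hli (p := c' * (D⁻¹ * γ 0 0) + d' * (D⁻¹ * γ 1 0))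
      (q := c' * (D⁻¹ * γ 0 1) + d' * (D⁻¹ * γ 1 1)) (r := 0) (s := 1)
      (by push_cast; linear_combination v2)
    have W2 := indep_eq hli (p := e) (q := f * (n : ℚ)⁻¹) (r := (n : ℚ)⁻¹ * (D⁻¹ * γ 1 0))
      (s := (n : ℚ)⁻¹ * (D⁻¹ * γ 1 1))
      (by push_cast; linear_combination w2)
    rw [← U1.1, ← U1.2, ← U2.1, ← U2.2] at V1 V2
    rw [← U2.1] at W2
    obtain ⟨V11, V12⟩ := V1
    obtain ⟨V21, V22⟩ := V2
    have hD : ((a * d - b * c : ℤ) : ℚ) = D⁻¹ := by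
      push_cast
      rw [U1.1, U1.2, U2.1, U2.2]
      field_simp
      linarith
    have hpos : 0 < a * d - b * c := by
      have : (0 : ℚ) < ((a * d - b * c : ℤ) : ℚ) := by rw [hD]; positivity
      exact_mod_cast this
    have hprod : (a * d - b * c) * (a' * d' - b' * c') = 1 := by
      have : (((a * d - b * c) * (a' * d' - b' * c') : ℤ) : ℚ) = 1 := by
        push_cast
        linear_combination (c' * b + d' * d : ℚ) * V11 - (c' * a + d' * c : ℚ) * V12 + V22
      exact_mod_cast this
    have hone : a * d - b * c = 1 := by
      rcases Int.eq_one_or_neg_one_of_mul_eq_one hprod with h | h <;> omega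
    have hD1 : D = 1 := by
      rw [hone] at hD
      rw [← inv_inv D, ← hD]; norm_num
    subst hD1
    refine ⟨!![a, b; c, d], by simp [Matrix.det_fin_two, hone], ⟨e, ?_⟩, ?_⟩
    · have h3 : (c : ℚ) = n * e := by
        rw [W2.1]; field_simp
      simp only [Matrix.of_apply, Matrix.cons_val', Matrix.cons_val_zero, Matrix.cons_val_one]
      exact_mod_cast h3
    · ext i j
      fin_cases i <;> fin_cases j <;> simp [U1.1, U1.2, U2.1, U2.2]
  · rintro ⟨g, hg, ⟨m, hm⟩, rfl⟩
    have hdet : (g.map (Int.cast : ℤ → ℚ)).det = 1 := by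
      rw [Matrix.det_fin_two] at hg ⊢
      simp only [Matrix.map_apply]
      exact_mod_cast hg
    rw [Matrix.det_fin_two] at hg
    have hgC : (g 0 0 : ℂ) * g 1 1 - g 0 1 * g 1 0 = 1 := by exact_mod_cast hg
    have hmC : (g 1 0 : ℂ) = n * m := by exact_mod_cast hm
    have A1 := act1 (g.map (Int.cast : ℤ → ℚ)) ψ
    have A2 := act2 (g.map (Int.cast : ℤ → ℚ)) ψ
    rw [hdet] at A1 A2
    simp only [Matrix.map_apply, Rat.cast_one, inv_one, one_mul, Rat.cast_intCast] at A1 A2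
    constructor
    · apply le_antisymm <;> rw [lat_le, mem_lat, mem_lat, A1, A2]
      · exact ⟨⟨_, _, rfl⟩, ⟨_, _, rfl⟩⟩
      · refine ⟨⟨g 1 1, -g 0 1, ?_⟩, ⟨-g 1 0, g 0 0, ?_⟩⟩
        · push_cast
          linear_combination ψ ![1, 0] * hgC
        · push_cast
          linear_combination ψ ![0, 1] * hgC
    · apply le_antisymm <;> rw [lat_le, mem_lat, mem_lat, actn1 n hn, actn2, actn1 n hn, actn2, A1, A2]
      · refine ⟨⟨g 0 0, g 0 1 * n, ?_⟩, ⟨m, g 1 1, ?_⟩⟩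
        · push_cast
          field_simp
        · rw [hmC]
          field_simp
      · rw [hmC] at hgC ⊢
        refine ⟨⟨g 1 1, -g 0 1 * n, ?_⟩, ⟨-m, g 0 0, ?_⟩⟩
        · push_cast
          field_simp
          linear_combination ψ ![1, 0] * hgC
        · push_cast
          field_simp
          linear_combination ψ ![0, 1] * hgC
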